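/- Let p be a prime, d ≥ 1, q = p^d, n ≥ 1, and let K be a field. Let 𝔽_q = GaloisField p d and 𝔤 = Matrix (Fin n) (Fin n) 𝔽_q. Let ρ : GL_n(DualNumber 𝔽_q) → GL_n(𝔽_q) and ρ' : GL_n(TruncatedWittVector p 2 𝔽_q) → GL_n(𝔽_q) be the group homomorphisms induced by reduction modulo the maximal ideal, and let σ : GL_n(𝔽_q) → GL_n(𝔽_q) be the automorphism raising each matrix entry to the p-th power. For an additive character F : 𝔤 → K (an element of AddChar 𝔤 K), define (g ·₁ F)(X) = F(ρ(g)⁻¹ · X · ρ(g)) for g ∈ GL_n(DualNumber 𝔽_q), and (g ·₂ F)(X) = F(σ(ρ'(g))⁻¹ · X · σ(ρ'(g))) for g ∈ GL_n(TruncatedWittVector p 2 𝔽_q). Then for any two additive characters χ, τ of 𝔤 valued in K: there exists g ∈ GL_n(TruncatedWittVector p 2 𝔽_q) with g ·₂ χ = τ if and only if there exists h ∈ GL_n(DualNumber 𝔽_q) with h ·₁ χ = τ. -/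

import Mathlib

open Matrix

/-- The reduction `W₂(R) → R` taking the zeroth Witt component, as a ring hom. -/
noncomputable def wittRed (p : ℕ) [Fact p.Prime] (R : Type*) [CommRing R] :
    TruncatedWittVector p 2 R →+* R where
  toFun x := x.coeff 0
  map_one' := by
    show TruncatedWittVector.coeff 0 (1 : TruncatedWittVector p 2 R) = 1
    rw [← map_one (WittVector.truncate (p := p) (R := R) 2), WittVector.coeff_truncate]
    simp
  map_zero' := by
    show TruncatedWittVector.coeff 0 (0 : TruncatedWittVector p 2 R) = 0
    rw [← map_zero (WittVector.truncate (p := p) (R := R) 2), WittVector.coeff_truncate]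
    simp
  map_mul' := by
    intro x y
    obtain ⟨a, ha⟩ := WittVector.truncate_surjective (p := p) 2 R x
    obtain ⟨b, hb⟩ := WittVector.truncate_surjective (p := p) 2 R y
    show TruncatedWittVector.coeff 0 (x * y) =
      TruncatedWittVector.coeff 0 x * TruncatedWittVector.coeff 0 y
    rw [← ha, ← hb, ← _root_.map_mul, WittVector.coeff_truncate, WittVector.coeff_truncate,
      WittVector.coeff_truncate]
    exact WittVector.mul_coeff_zero a b
  map_add' := by
    intro x y
    obtain ⟨a, ha⟩ := WittVector.truncate_surjective (p := p) 2 R x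
    obtain ⟨b, hb⟩ := WittVector.truncate_surjective (p := p) 2 R y
    show TruncatedWittVector.coeff 0 (x + y) =
      TruncatedWittVector.coeff 0 x + TruncatedWittVector.coeff 0 y
    rw [← ha, ← hb, ← _root_.map_add, WittVector.coeff_truncate, WittVector.coeff_truncate,
      WittVector.coeff_truncate]
    exact WittVector.add_coeff_zero a b

/-- The reduction `R[ε]/(ε²) → R` modulo the maximal ideal `(ε)`, as a ring hom. -/
noncomputable def dualRed (R : Type*) [CommRing R] : DualNumber R →+* R :=
  (TrivSqZeroExt.fstHom R R R).toRingHom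

/-- A surjective local ring homomorphism induces a surjection on general linear groups. -/
theorem generalLinearGroup_map_surjective {n R S : Type*} [Fintype n] [DecidableEq n]
    [CommRing R] [CommRing S] (f : R →+* S) [IsLocalHom f] (hf : Function.Surjective f) :
    Function.Surjective (Matrix.GeneralLinearGroup.map (n := n) f) := by
  intro A
  obtain ⟨s, hs⟩ := hf.hasRightInverse
  have hB : f.mapMatrix ((A : Matrix n n S).map s) = A := by
    ext i j
    simp [hs _]
  have hu : IsUnit ((A : Matrix n n S).map s) := by
    rw [Matrix.isUnit_iff_isUnit_det]
    refine isUnit_of_map_unit f _ ?_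
    rw [f.map_det, hB]
    exact (Matrix.isUnit_iff_isUnit_det _).mp A.isUnit
  refine ⟨hu.unit, Units.ext ?_⟩
  exact hB

theorem isLocalHom_dualRed (R : Type*) [CommRing R] : IsLocalHom (dualRed R) where
  map_nonunit _ hx := TrivSqZeroExt.isUnit_iff_isUnit_fst.mpr hx

theorem dualRed_surjective (R : Type*) [CommRing R] : Function.Surjective (dualRed R) :=
  TrivSqZeroExt.fst_surjective

theorem wittRed_truncate (p : ℕ) [Fact p.Prime] {R : Type*} [CommRing R] (x : WittVector p R) :
    wittRed p R (WittVector.truncate 2 x) = x.coeff 0 :=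
  WittVector.coeff_truncate x 0

theorem isLocalHom_wittRed (p : ℕ) [Fact p.Prime] (k : Type*) [Field k] [CharP k p]
    [PerfectRing k p] : IsLocalHom (wittRed p k) where
  map_nonunit x hx := by
    obtain ⟨a, rfl⟩ := WittVector.truncate_surjective (p := p) 2 k x
    rw [wittRed_truncate] at hx
    exact (WittVector.isUnit_of_coeff_zero_ne_zero a hx.ne_zero).map _

theorem wittRed_surjective (p : ℕ) [Fact p.Prime] (R : Type*) [CommRing R] :
    Function.Surjective (wittRed p R) := fun r =>
  ⟨WittVector.truncate 2 (WittVector.teichmuller p r), by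
    rw [wittRed_truncate, WittVector.teichmuller_coeff_zero]⟩

/-- **Lemma 3.1 for `GLₙ`.** Two additive characters `χ, τ` of `𝔤 = Mₙ(𝔽_q)` are conjugate
under the (Frobenius-twisted adjoint) action of `GLₙ(W₂(𝔽_q))` if and only if they are
conjugate under the adjoint action of `GLₙ(𝔽_q[t]/t²)`. -/
theorem addChar_conjugate_iff_GL
    (p d n : ℕ) [Fact p.Prime] (hd : 1 ≤ d) (hn : 1 ≤ n) (q : ℕ) (hq : q = p ^ d)
    (K : Type*) [Field K]
    (ρ : GL (Fin n) (DualNumber (GaloisField p d)) →* GL (Fin n) (GaloisField p d))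
    (hρ : ρ = Matrix.GeneralLinearGroup.map (dualRed (GaloisField p d)))
    (ρ' : GL (Fin n) (TruncatedWittVector p 2 (GaloisField p d)) →*
      GL (Fin n) (GaloisField p d))
    (hρ' : ρ' = Matrix.GeneralLinearGroup.map (wittRed p (GaloisField p d)))
    (σ : GL (Fin n) (GaloisField p d) →* GL (Fin n) (GaloisField p d))
    (hσ : σ = Matrix.GeneralLinearGroup.map (frobenius (GaloisField p d) p))
    (χ τ : AddChar (Matrix (Fin n) (Fin n) (GaloisField p d)) K) :
    (∃ g : GL (Fin n) (TruncatedWittVector p 2 (GaloisField p d)),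
      ∀ X : Matrix (Fin n) (Fin n) (GaloisField p d),
        χ ((↑((σ (ρ' g))⁻¹) : Matrix (Fin n) (Fin n) (GaloisField p d)) * X * (↑(σ (ρ' g)) : Matrix (Fin n) (Fin n) (GaloisField p d)))
          = τ X) ↔
    (∃ h : GL (Fin n) (DualNumber (GaloisField p d)),
      ∀ X : Matrix (Fin n) (Fin n) (GaloisField p d),
        χ ((↑((ρ h)⁻¹) : Matrix (Fin n) (Fin n) (GaloisField p d)) * X * (↑(ρ h) : Matrix (Fin n) (Fin n) (GaloisField p d))) = τ X) := by
  subst hρ hρ' hσ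
  have := isLocalHom_dualRed (GaloisField p d)
  have := isLocalHom_wittRed p (GaloisField p d)
  have h₁ := generalLinearGroup_map_surjective (n := Fin n) _
    (dualRed_surjective (GaloisField p d))
  have h₂ := generalLinearGroup_map_surjective (n := Fin n) _
    (wittRed_surjective p (GaloisField p d))
  have h₃ := generalLinearGroup_map_surjective (n := Fin n) _
    (surjective_frobenius (GaloisField p d) p)
  let P (g : GL (Fin n) (GaloisField p d)) : Prop :=
    ∀ X : Matrix (Fin n) (Fin n) (GaloisField p d), χ (g⁻¹.val * X * g.val) = τ X
  exact ((h₃.comp h₂).exists (p := P)).symm.trans (h₁.exists (p := P))
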